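/- Polynomial analogue of Serret's theorem: let K be a field and let α, β ∈ K((T⁻¹)) be irrational Laurent series (α, β ∉ K(T)), with complete quotients α_n and β_m and partial quotients a_n and b_m respectively. Then the following are equivalent: (1) α and β are equivalent; (2) there exist m, n ∈ ℕ and ℓ ∈ K \ {0} such that ℓ·α_n = β_m; (3) the continued fraction expansions of α and β eventually coincide up to multiplication by a constant, i.e. there exist n, m ∈ ℕ and ℓ ∈ K \ {0} such that α = [a_0, …, a_{n−1}, c_1, c_2, c_3, …] and β = [b_0, …, b_{m−1}, ℓc_1, ℓ⁻¹c_2, ℓc_3, …] for some sequence (c_j). -/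

import Mathlib

noncomputable section

namespace PaperCF

variable {K : Type*} [Field K]

/-- The element `T` of `K((T⁻¹))`, where `K((T⁻¹))` is modeled as the field
`LaurentSeries K` of Laurent series in the variable `t = T⁻¹`. -/
def Tvar (K : Type*) [Field K] : LaurentSeries K := (HahnSeries.single (-1 : ℤ) (1 : K))

/-- The embedding of `K[T]` into `K((T⁻¹))`, sending the polynomial variable to `T = t⁻¹`. -/
def emb : Polynomial K →+* LaurentSeries K := (Polynomial.aeval (Tvar K)).toRingHom

/-- The polynomial part `⌊α⌋` of a formal Laurent series `α ∈ K((T⁻¹))`. -/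
def polyPart (α : LaurentSeries K) : Polynomial K :=
  ∑ i ∈ Finset.range ((-α.order).toNat + 1), Polynomial.monomial i (α.coeff (-(i : ℤ)))

/-- The complete quotients `αₙ` of the regular continued fraction expansion of `α`
(with the convention `0⁻¹ = 0`, so that `cq α n = 0` for all `n` past the end of a
finite expansion). -/
def cq (α : LaurentSeries K) : ℕ → LaurentSeries K
  | 0 => α
  | n + 1 => (cq α n - emb (polyPart (cq α n)))⁻¹

/-- The partial quotients `aₙ = ⌊αₙ⌋` of the regular continued fraction expansion of `α`. -/
def pq (α : LaurentSeries K) (n : ℕ) : Polynomial K := polyPart (cq α n)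

/-- The continuants `(pₙ, qₙ)` of the regular continued fraction expansion of `α`. -/
def cont (α : LaurentSeries K) : ℕ → Polynomial K × Polynomial K
  | 0 => (pq α 0, 1)
  | 1 => (pq α 1 * pq α 0 + 1, pq α 1)
  | n + 2 => (pq α (n + 2) * (cont α (n + 1)).1 + (cont α n).1,
              pq α (n + 2) * (cont α (n + 1)).2 + (cont α n).2)

/-- `pₙ`. -/
def contP (α : LaurentSeries K) (n : ℕ) : Polynomial K := (cont α n).1

/-- `qₙ`. -/
def contQ (α : LaurentSeries K) (n : ℕ) : Polynomial K := (cont α n).2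

/-- The `n`-th partial quotient (and hence the `n`-th convergent) of `α` genuinely exists. -/
def ConvAt (α : LaurentSeries K) (n : ℕ) : Prop := n = 0 ∨ cq α n ≠ 0

/-- `K(α) = sup_{n ≥ 1} deg aₙ`, as an extended natural number. -/
def KK (α : LaurentSeries K) : ℕ∞ :=
  ⨆ n : {n : ℕ // 1 ≤ n ∧ cq α n ≠ 0}, ((pq α n.1).natDegree : ℕ∞)

/-- `ōK(α) = limsup_n deg aₙ`. -/
def KKbar (α : LaurentSeries K) : ℕ∞ :=
  Filter.limsup (fun n => ((pq α n).natDegree : ℕ∞)) Filter.atTop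

/-- `α` is a rational function, i.e. an element of `K(T) ⊆ K((T⁻¹))`. -/
def IsRat (α : LaurentSeries K) : Prop :=
  ∃ p q : Polynomial K, q ≠ 0 ∧ α * emb q = emb p

/-- Two Laurent series are equivalent if they differ by a Möbius transformation with
matrix in `GL₂(K[T])`. -/
def MEquiv (α β : LaurentSeries K) : Prop :=
  ∃ a b c d : Polynomial K, IsUnit (a * d - b * c) ∧
    emb c * α + emb d ≠ 0 ∧ β = (emb a * α + emb b) / (emb c * α + emb d)

end PaperCF

namespace PaperCF

variable {K : Type*} [Field K]

theorem emb_monomial (n : ℕ) (r : K) :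
    emb (Polynomial.monomial n r) = HahnSeries.single (-(n : ℤ)) r := by
  change Polynomial.aeval (Tvar K) _ = _
  have hC : algebraMap K (LaurentSeries K) r = HahnSeries.C r :=
    HahnSeries.ofPowerSeries_C r
  rw [Polynomial.aeval_monomial, Tvar, HahnSeries.single_pow, hC, HahnSeries.C_apply,
    HahnSeries.single_mul_single]
  simp

theorem emb_C (r : K) : emb (Polynomial.C r) = HahnSeries.C r := by
  rw [← Polynomial.monomial_zero_left, emb_monomial]
  simp

theorem coeff_emb (p : Polynomial K) (n : ℕ) : (emb p).coeff (-(n : ℤ)) = p.coeff n := by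
  induction p using Polynomial.induction_on' with
  | add p q hp hq => simp [map_add, hp, hq]
  | monomial i r =>
    rw [emb_monomial, HahnSeries.coeff_single, Polynomial.coeff_monomial]
    simp [eq_comm]

theorem emb_injective : Function.Injective (emb (K := K)) := fun p q h => by
  ext n
  rw [← coeff_emb, h, coeff_emb]

theorem emb_ne_zero {p : Polynomial K} (hp : p ≠ 0) : emb p ≠ 0 :=
  (map_ne_zero_iff emb emb_injective).2 hp

theorem emb_C_inv (r : K) : emb (Polynomial.C r⁻¹) = (emb (Polynomial.C r))⁻¹ :=
  map_inv₀ (emb.comp Polynomial.C) r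

theorem coeff_polyPart (α : LaurentSeries K) (n : ℕ) :
    (polyPart α).coeff n = α.coeff (-(n : ℤ)) := by
  rw [polyPart, Polynomial.finsetSum_coeff]
  simp only [Polynomial.coeff_monomial, Finset.sum_ite_eq', Finset.mem_range]
  split_ifs with h
  · rfl
  · exact (HahnSeries.coeff_eq_zero_of_lt_order (by omega)).symm

/-- `|x| < 1`: all coefficients of `x` at nonnegative powers of `T` vanish. -/
def Small (x : LaurentSeries K) : Prop := ∀ n : ℕ, x.coeff (-(n : ℤ)) = 0

theorem small_iff {x : LaurentSeries K} : Small x ↔ x = 0 ∨ 0 < x.order := by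
  constructor
  · intro h
    by_contra! hx
    have := h (-x.order).toNat
    rw [Int.toNat_of_nonneg (by omega), neg_neg] at this
    exact hx.1 (HahnSeries.coeff_order_eq_zero.1 this)
  · rintro (rfl | h) n
    · simp
    · exact HahnSeries.coeff_eq_zero_of_lt_order (by omega)

theorem small_sub_emb_iff {α : LaurentSeries K} {p : Polynomial K} :
    Small (α - emb p) ↔ polyPart α = p := by
  simp only [Small, HahnSeries.coeff_sub, coeff_emb, sub_eq_zero, Polynomial.ext_iff,
    coeff_polyPart]

theorem small_sub_polyPart (α : LaurentSeries K) : Small (α - emb (polyPart α)) :=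
  small_sub_emb_iff.2 rfl

theorem polyPart_eq_zero {α : LaurentSeries K} (h : Small α) : polyPart α = 0 :=
  small_sub_emb_iff.1 (by simpa using h)

theorem polyPart_add_emb (α : LaurentSeries K) (p : Polynomial K) :
    polyPart (α + emb p) = polyPart α + p := by
  ext n
  simp [coeff_polyPart, coeff_emb]

theorem polyPart_C_mul (l : K) (α : LaurentSeries K) :
    polyPart (emb (Polynomial.C l) * α) = Polynomial.C l * polyPart α := by
  ext n
  simp [coeff_polyPart, emb_C]

theorem order_inv {x : LaurentSeries K} (hx : x ≠ 0) : x⁻¹.order = -x.order := by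
  have h := HahnSeries.order_mul hx (inv_ne_zero hx)
  rw [mul_inv_cancel₀ hx, HahnSeries.order_one] at h
  omega

theorem Small.mul_of_order_eq_zero {x y : LaurentSeries K} (hx : Small x) (hy : y.order = 0) :
    Small (x * y) := by
  rw [small_iff] at hx ⊢
  by_cases h : x * y = 0
  · exact Or.inl h
  · rw [mul_eq_zero, not_or] at h
    rw [HahnSeries.order_mul h.1 h.2]
    exact Or.inr (by have := hx.resolve_left h.1; omega)

theorem cq_one (α : LaurentSeries K) : cq α 1 = (α - emb (polyPart α))⁻¹ := rfl

theorem cq_add (α : LaurentSeries K) (n m : ℕ) : cq α (n + m) = cq (cq α n) m := by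
  induction m with
  | zero => rfl
  | succ m ih => rw [← add_assoc, cq, cq, ih]

theorem pq_cq (α : LaurentSeries K) (n m : ℕ) : pq (cq α n) m = pq α (n + m) := by
  rw [pq, pq, cq_add]

theorem cq_C_mul (l : K) (α : LaurentSeries K) (j : ℕ) :
    cq (emb (Polynomial.C l) * α) j =
      emb (Polynomial.C (if Even j then l else l⁻¹)) * cq α j := by
  induction j with
  | zero => simp [cq]
  | succ j ih =>
    rw [cq, cq, ih, polyPart_C_mul, map_mul, ← mul_sub, mul_inv]
    congr 1
    simp only [emb_C, Nat.even_add_one]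
    split_ifs <;> simp_all

theorem pq_C_mul (l : K) (α : LaurentSeries K) (j : ℕ) :
    pq (emb (Polynomial.C l) * α) j =
      Polynomial.C (if Even j then l else l⁻¹) * pq α j := by
  rw [pq, cq_C_mul, polyPart_C_mul, pq]

/-- Some complete quotients of `α` and `β` agree up to a nonzero constant factor. -/
def CQEquiv (α β : LaurentSeries K) : Prop :=
  ∃ (m n : ℕ) (l : K), l ≠ 0 ∧ emb (Polynomial.C l) * cq α n = cq β m

theorem CQEquiv.symm {α β : LaurentSeries K} (h : CQEquiv α β) : CQEquiv β α := by
  obtain ⟨m, n, l, hl, h⟩ := h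
  refine ⟨n, m, l⁻¹, inv_ne_zero hl, ?_⟩
  rw [← h, ← mul_assoc, ← map_mul, ← map_mul, inv_mul_cancel₀ hl, map_one, map_one, one_mul]

theorem CQEquiv.trans {α β γ : LaurentSeries K} (h₁ : CQEquiv α β) (h₂ : CQEquiv β γ) :
    CQEquiv α γ := by
  obtain ⟨m, n, l, hl, h⟩ := h₁
  obtain ⟨k, m', l', hl', h'⟩ := h₂
  have e := cq_C_mul l (cq α n) m'
  have e' := cq_C_mul l' (cq β m') m
  rw [h, ← cq_add, ← cq_add] at e
  rw [h', ← cq_add, ← cq_add, add_comm m' m, e, ← mul_assoc, ← map_mul, ← map_mul] at e'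
  refine ⟨_, _, _, ?_, e'.symm⟩
  split_ifs <;> simp [hl, hl']

theorem CQEquiv.of_cq_eq {α β : LaurentSeries K} {m n : ℕ} (h : cq α n = cq β m) :
    CQEquiv α β :=
  ⟨m, n, 1, one_ne_zero, by simp [h]⟩

theorem CQEquiv.cq_right (α : LaurentSeries K) (n : ℕ) : CQEquiv α (cq α n) :=
  .of_cq_eq (n := n) (m := 0) rfl

theorem CQEquiv.C_mul_right {l : K} (hl : l ≠ 0) (α : LaurentSeries K) :
    CQEquiv α (emb (Polynomial.C l) * α) :=
  ⟨0, 0, l, hl, rfl⟩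

theorem CQEquiv.add_emb_right (α : LaurentSeries K) (p : Polynomial K) :
    CQEquiv α (α + emb p) :=
  .of_cq_eq (n := 1) (m := 1) (by
    rw [cq_one, cq_one, polyPart_add_emb, map_add, add_sub_add_right_eq_sub])

theorem CQEquiv.inv_of_small {α : LaurentSeries K} (h : Small α) : CQEquiv α α⁻¹ :=
  .of_cq_eq (n := 1) (m := 0) (by rw [cq_one, polyPart_eq_zero h]; simp [cq])

theorem CQEquiv.inv_right (α : LaurentSeries K) : CQEquiv α α⁻¹ := by
  by_cases h0 : α = 0
  · exact .of_cq_eq (n := 0) (m := 0) (by simp [h0])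
  rcases lt_trichotomy α.order 0 with h | h | h
  · have := CQEquiv.inv_of_small (α := α⁻¹) (small_iff.2 (Or.inr (by rw [order_inv h0]; omega)))
    rw [inv_inv] at this
    exact this.symm
  · set a := α.coeff 0 with ha
    have ha0 : a ≠ 0 := by rw [ha, ← h]; exact HahnSeries.coeff_order_eq_zero.not.2 h0
    have hE : emb (Polynomial.C a) ≠ 0 := emb_ne_zero (by simpa using ha0)
    have hE' := emb_C_inv a
    have hp : polyPart α = Polynomial.C a := by
      ext n
      rw [coeff_polyPart, Polynomial.coeff_C]
      split_ifs with hn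
      · simp [hn, ha]
      · exact HahnSeries.coeff_eq_zero_of_lt_order (by omega)
    have hs : Small (α - emb (Polynomial.C a)) := small_sub_emb_iff.2 hp
    have key : α⁻¹ - emb (Polynomial.C a⁻¹) =
        (α - emb (Polynomial.C a)) * (α⁻¹ * emb (Polynomial.C (-a⁻¹))) := by
      rw [map_neg, map_neg, hE']
      field_simp
      ring
    have hp' : polyPart α⁻¹ = Polynomial.C a⁻¹ := by
      rw [← small_sub_emb_iff, key]
      refine hs.mul_of_order_eq_zero ?_
      rw [emb_C, HahnSeries.order_mul (inv_ne_zero h0) (by simpa using ha0),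
        HahnSeries.order_C, order_inv h0, h]
      rfl
    by_cases hδ : α = emb (Polynomial.C a)
    · refine .of_cq_eq (n := 1) (m := 1) ?_
      rw [cq_one, cq_one, hp, hp', key, hδ]
      simp
    · have e : cq α⁻¹ 1 = emb (Polynomial.C (-a ^ 2)) * cq α 1 + emb (Polynomial.C (-a)) := by
        have hδ' := sub_ne_zero.2 hδ
        rw [cq_one, cq_one, hp, hp', hE']
        rw [inv_sub_inv h0 hE, inv_div, ← neg_sub α, div_neg]
        simp only [map_neg, map_pow]
        field_simp
        ring
      refine (CQEquiv.cq_right α 1).trans (CQEquiv.trans ?_ (CQEquiv.cq_right α⁻¹ 1).symm)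
      rw [e]
      exact (CQEquiv.C_mul_right (by simpa using ha0) _).trans (CQEquiv.add_emb_right _ _)
  · exact .inv_of_small (small_iff.2 (Or.inr h))

theorem eq_zero_of_emb_mul_add_eq_zero {α : LaurentSeries K} (hα : ¬ IsRat α)
    {c d : Polynomial K} (h : emb c * α + emb d = 0) : c = 0 ∧ d = 0 := by
  have hc : c = 0 := by
    by_contra hc
    exact hα ⟨-d, c, hc, by rw [map_neg]; linear_combination h⟩
  subst hc
  refine ⟨rfl, emb_injective ?_⟩
  simpa using h

theorem MEquiv.not_isRat {α β : LaurentSeries K} (h : MEquiv α β) (hα : ¬ IsRat α) :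
    ¬ IsRat β := by
  obtain ⟨a, b, c, d, hu, hne, rfl⟩ := h
  rintro ⟨p, q, hq, h⟩
  rw [div_mul_eq_mul_div, div_eq_iff hne] at h
  obtain ⟨h₁, h₂⟩ := eq_zero_of_emb_mul_add_eq_zero hα
    (c := a * q - p * c) (d := b * q - p * d) (by
      simp only [map_sub, map_mul]
      linear_combination h)
  have : (a * d - b * c) * q = 0 := by linear_combination d * h₁ - c * h₂
  exact (mul_ne_zero hu.ne_zero hq) this

theorem MEquiv.symm {α β : LaurentSeries K} (h : MEquiv α β) : MEquiv β α := by
  obtain ⟨a, b, c, d, hu, hne, rfl⟩ := h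
  have hdet : emb a * emb d - emb b * emb c ≠ 0 := by
    simpa only [map_sub, map_mul] using emb_ne_zero hu.ne_zero
  have hden : emb (-c) * ((emb a * α + emb b) / (emb c * α + emb d)) + emb a =
      (emb a * emb d - emb b * emb c) / (emb c * α + emb d) := by
    rw [mul_div_assoc', div_add' _ _ _ hne, map_neg]
    ring
  refine ⟨d, -b, -c, a, by convert hu using 1; ring, ?_, ?_⟩
  · rw [hden]
    exact div_ne_zero hdet hne
  · rw [hden, eq_div_iff (div_ne_zero hdet hne), mul_div_assoc', mul_div_assoc',
      div_add' _ _ _ hne, map_neg]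
    ring

theorem MEquiv.trans {α β γ : LaurentSeries K} (h₁ : MEquiv α β) (h₂ : MEquiv β γ) :
    MEquiv α γ := by
  obtain ⟨a, b, c, d, hu, hne, rfl⟩ := h₁
  obtain ⟨a', b', c', d', hu', hne', rfl⟩ := h₂
  have key (x y : Polynomial K) :
      emb x * ((emb a * α + emb b) / (emb c * α + emb d)) + emb y =
        (emb (x * a + y * c) * α + emb (x * b + y * d)) / (emb c * α + emb d) := by
    rw [mul_div_assoc', div_add' _ _ _ hne]
    simp only [map_add, map_mul]
    ring
  rw [key] at hne'
  refine ⟨a' * a + b' * c, a' * b + b' * d, c' * a + d' * c, c' * b + d' * d,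
    by convert hu'.mul hu using 1; ring, (div_ne_zero_iff.1 hne').1, ?_⟩
  rw [key, key, div_div_div_cancel_right₀ hne]

theorem MEquiv.C_mul_right {l : K} (hl : l ≠ 0) (α : LaurentSeries K) :
    MEquiv α (emb (Polynomial.C l) * α) :=
  ⟨Polynomial.C l, 0, 0, 1, by simpa using hl, by simp, by simp⟩

theorem MEquiv.cq_right {α : LaurentSeries K} (hα : ¬ IsRat α) (n : ℕ) :
    MEquiv α (cq α n) := by
  induction n with
  | zero => exact ⟨1, 0, 0, 1, by simp, by simp, by simp [cq]⟩
  | succ n ih =>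
    refine ih.trans ⟨0, 1, 1, -polyPart (cq α n), by simp, fun h => ?_, ?_⟩
    · exact one_ne_zero (eq_zero_of_emb_mul_add_eq_zero (ih.not_isRat hα) h).1
    · simp [cq, sub_eq_add_neg]

theorem MEquiv.cqEquiv {α β : LaurentSeries K} (hα : ¬ IsRat α) (h : MEquiv α β) :
    CQEquiv α β := by
  obtain ⟨a, b, c, d, hu, hne, rfl⟩ := h
  induction c, a using EuclideanDomain.GCD.induction generalizing b d with
  | H0 a =>
    rw [mul_zero, sub_zero] at hu
    obtain ⟨r, hr, rfl⟩ := Polynomial.isUnit_iff.1 (isUnit_of_mul_isUnit_left hu)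
    obtain ⟨s, hs, rfl⟩ := Polynomial.isUnit_iff.1 (isUnit_of_mul_isUnit_right hu)
    have e : (emb (Polynomial.C r) * α + emb b) / (emb 0 * α + emb (Polynomial.C s)) =
        emb (Polynomial.C (r * s⁻¹)) * α + emb (b * Polynomial.C s⁻¹) := by
      simp only [map_mul, map_zero, emb_C_inv, zero_mul, zero_add]
      field_simp
    rw [e]
    exact (CQEquiv.C_mul_right (mul_ne_zero hr.ne_zero (inv_ne_zero hs.ne_zero)) _).trans
      (CQEquiv.add_emb_right _ _)
  | H1 c a hc ih =>
    have hdiv : emb a = emb c * emb (a / c) + emb (a % c) := by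
      rw [← map_mul, ← map_add, EuclideanDomain.div_add_mod]
    have hu' : IsUnit (c * (b - a / c * d) - d * (a % c)) := by
      convert hu.neg using 1
      linear_combination (-d) * EuclideanDomain.div_add_mod a c
    have hne' : emb (a % c) * α + emb (b - a / c * d) ≠ 0 := fun h => by
      obtain ⟨h₁, h₂⟩ := eq_zero_of_emb_mul_add_eq_zero hα h
      simp [h₁, h₂] at hu'
    have e : (emb a * α + emb b) / (emb c * α + emb d) =
        ((emb c * α + emb d) / (emb (a % c) * α + emb (b - a / c * d)))⁻¹ + emb (a / c) := by
      rw [inv_div, div_add' _ _ _ hne, hdiv]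
      simp only [map_sub, map_mul]
      ring
    rw [e]
    exact ((ih _ _ hu' hne').trans (CQEquiv.inv_right _)).trans (CQEquiv.add_emb_right _ _)

theorem mEquiv_iff_cqEquiv {α β : LaurentSeries K} (hα : ¬ IsRat α) (hβ : ¬ IsRat β) :
    MEquiv α β ↔ CQEquiv α β := by
  refine ⟨MEquiv.cqEquiv hα, ?_⟩
  rintro ⟨m, n, l, hl, h⟩
  refine (MEquiv.cq_right hα n).trans (MEquiv.trans ?_ (MEquiv.cq_right hβ m).symm)
  rw [← h]
  exact MEquiv.C_mul_right hl _

theorem sub_polyPart_ne_zero {α : LaurentSeries K} (hα : ¬ IsRat α) :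
    α - emb (polyPart α) ≠ 0 := fun h =>
  hα ⟨polyPart α, 1, one_ne_zero, by simpa using sub_eq_zero.1 h⟩

theorem order_sub_gt_of_pq_eq (k : ℕ) {γ δ : LaurentSeries K} (hγ : ¬ IsRat γ)
    (hδ : ¬ IsRat δ) (h : ∀ j, pq γ j = pq δ j) (hne : γ ≠ δ) :
    (k : ℤ) < (γ - δ).order := by
  have h0 : polyPart γ = polyPart δ := h 0
  have hγ' := sub_polyPart_ne_zero hγ
  have hδ' := sub_polyPart_ne_zero hδ
  induction k generalizing γ δ with
  | zero =>
    have : Small (γ - δ) := fun n => by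
      rw [HahnSeries.coeff_sub, ← coeff_polyPart, ← coeff_polyPart, h0, sub_self]
    exact (small_iff.1 this).resolve_left (sub_ne_zero.2 hne)
  | succ k ih =>
    have hγ₁ : ¬ IsRat (cq γ 1) := (MEquiv.cq_right hγ 1).not_isRat hγ
    have hδ₁ : ¬ IsRat (cq δ 1) := (MEquiv.cq_right hδ 1).not_isRat hδ
    have hne₁ : cq γ 1 ≠ cq δ 1 := fun e => hne (by
      rw [cq_one, cq_one, h0] at e
      exact sub_left_injective (inv_injective e))
    have h₁ : ∀ j, pq (cq γ 1) j = pq (cq δ 1) j := fun j => by rw [pq_cq, pq_cq, h]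
    have := ih hγ₁ hδ₁ h₁ hne₁ (h₁ 0) (sub_polyPart_ne_zero hγ₁) (sub_polyPart_ne_zero hδ₁)
    have sγ := (small_iff.1 (small_sub_polyPart γ)).resolve_left hγ'
    have sδ := (small_iff.1 (small_sub_polyPart δ)).resolve_left hδ'
    have e : γ - δ = -((cq γ 1 - cq δ 1) *
        ((γ - emb (polyPart γ)) * (δ - emb (polyPart δ)))) := by
      rw [cq_one, cq_one]
      field_simp
      rw [h0]
      ring
    rw [e, HahnSeries.order_neg, HahnSeries.order_mul (sub_ne_zero.2 hne₁) (mul_ne_zero hγ' hδ'),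
      HahnSeries.order_mul hγ' hδ']
    push_cast
    omega

theorem eq_of_pq_eq {γ δ : LaurentSeries K} (hγ : ¬ IsRat γ) (hδ : ¬ IsRat δ)
    (h : ∀ j, pq γ j = pq δ j) : γ = δ := by
  by_contra hne
  have := order_sub_gt_of_pq_eq (γ - δ).order.toNat hγ hδ h hne
  omega

theorem C_mul_cq_eq_iff {α β : LaurentSeries K} (hα : ¬ IsRat α) (hβ : ¬ IsRat β)
    (m n : ℕ) {l : K} (hl : l ≠ 0) :
    emb (Polynomial.C l) * cq α n = cq β m ↔
      ∀ j, pq β (m + j) = Polynomial.C (if Even j then l else l⁻¹) * pq α (n + j) := by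
  refine ⟨fun h j => ?_, fun h => ?_⟩
  · rw [← pq_cq, ← h, pq_C_mul, pq_cq]
  · have hα' := (MEquiv.cq_right hα n).not_isRat hα
    refine eq_of_pq_eq ((MEquiv.C_mul_right hl _).not_isRat hα')
      ((MEquiv.cq_right hβ m).not_isRat hβ) fun j => ?_
    rw [pq_C_mul, pq_cq, pq_cq, h]

end PaperCF

open PaperCF in
/-- **polynomial analogue of Serret's theorem.** For irrational Laurent
series `α, β`, the following are equivalent: (1) `α` and `β` are `GL₂(K[T])`-equivalent;
(2) some complete quotients satisfy `ℓ·αₙ = βₘ` with `ℓ ∈ K \ {0}`; (3) the continued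
fractions of `α` and `β` eventually coincide up to multiplication by the constant `ℓ`
(alternating with `ℓ⁻¹`). -/
theorem serret_polynomial {K : Type*} [Field K] (α β : LaurentSeries K)
    (hα : ¬ IsRat α) (hβ : ¬ IsRat β) :
    (MEquiv α β ↔
      ∃ (m n : ℕ) (l : K), l ≠ 0 ∧ emb (Polynomial.C l) * cq α n = cq β m) ∧
    ((∃ (m n : ℕ) (l : K), l ≠ 0 ∧ emb (Polynomial.C l) * cq α n = cq β m) ↔
      ∃ (n m : ℕ) (l : K), l ≠ 0 ∧ ∀ j : ℕ,
        pq β (m + j) = Polynomial.C (if Even j then l else l⁻¹) * pq α (n + j)) := by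
  refine ⟨mEquiv_iff_cqEquiv hα hβ, ?_⟩
  constructor
  · rintro ⟨m, n, l, hl, h⟩
    exact ⟨n, m, l, hl, (C_mul_cq_eq_iff hα hβ m n hl).1 h⟩
  · rintro ⟨n, m, l, hl, h⟩
    exact ⟨m, n, l, hl, (C_mul_cq_eq_iff hα hβ m n hl).2 h⟩
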